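/- arXiv:2302.03811 — 2 statements merged into one kernel-verified Lean document; each statement's English description precedes it below -/
import Mathlib

section
/- (Key recursion in the proof of Theorem 4) Suppose m_k < C for all k. Then there exist an integer k ≥ 1 and γ ∈ (0,1) such that for all n ≥ k the MPI iterates satisfy u_n ≤ γ ℓ_{n−k} + (1 − γ) u_{n−k}. -/
/-- Bellman operator of a policy `f`. -/
noncomputable def Tpol {S A : Type*} [Fintype S]
    (Q : S → A → S → ℝ) (d : S → A → ℝ) (α : ℝ) (f : S → A) (v : S → ℝ) (i : S) : ℝ :=
  Real.exp (α * d i (f i)) * ∑ j, Q i (f i) j * v j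

/-- Bellman optimality operator. -/
noncomputable def Topt {S A : Type*} [Fintype S] [Nonempty A]
    (Q : S → A → S → ℝ) (d : S → A → ℝ) (α : ℝ) (v : S → ℝ) (i : S) : ℝ :=
  ⨅ a : A, Real.exp (α * d i a) * ∑ j, Q i a j * v j

/-- The stochastic matrix of a policy `f`: `(Q_f)(i,j) = Q(j|i,f(i))`. -/
def policyMatrix {S A : Type*} (Q : S → A → S → ℝ) (f : S → A) : Matrix S S ℝ :=
  Matrix.of fun i j => Q i (f i) j

/-- If some power of a nonnegative matrix leads from the complement of `R` into `R`, then a single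
positive entry does. -/
lemma Matrix.exists_pos_entry_of_pow_pos {S : Type*} [Fintype S] [DecidableEq S]
    {M : Matrix S S ℝ} (hM : ∀ i j, 0 ≤ M i j) {R : Set S} {i j : S} (hi : i ∉ R) (hj : j ∈ R)
    {k : ℕ} (hk : 0 < (M ^ k) i j) : ∃ a ∉ R, ∃ b ∈ R, 0 < M a b := by
  by_contra! h
  have hzero : ∀ a ∉ R, ∀ b ∈ R, M a b = 0 := fun a ha b hb =>
    le_antisymm (h a ha b hb) (hM a b)
  have hpow : ∀ k : ℕ, ∀ b ∈ R, (M ^ k) i b = 0 := by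
    intro k
    induction k with
    | zero =>
      intro b hb
      rw [pow_zero, Matrix.one_apply_ne]
      rintro rfl
      exact hi hb
    | succ k ih =>
      intro b hb
      rw [pow_succ, Matrix.mul_apply]
      refine Finset.sum_eq_zero fun l _ => ?_
      by_cases hl : l ∈ R
      · rw [ih l hl, zero_mul]
      · rw [hzero l hl b hb, mul_zero]
  exact hk.ne' (hpow k j hj)

/-- An increasing sequence of sets, started from a nonempty one, that grows strictly until it is
everything, is everything after `card S` steps. -/
lemma eq_univ_of_strict_growth {S : Type*} [Fintype S] (R : ℕ → Set S) (h0 : (R 0).Nonempty)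
    (hmono : ∀ t, R t ⊆ R (t + 1))
    (hgrow : ∀ t, (R t).Nonempty → R t ≠ Set.univ → ∃ i ∉ R t, i ∈ R (t + 1)) :
    R (Fintype.card S) = Set.univ := by
  have hne : ∀ t, (R t).Nonempty := fun t => by
    induction t with
    | zero => exact h0
    | succ t ih => exact ih.mono (hmono t)
  have hcard : ∀ t, R t = Set.univ ∨ t < (R t).ncard := by
    intro t
    induction t with
    | zero => exact Or.inr ((Set.ncard_pos).2 h0)
    | succ t ih =>
      by_cases hu : R t = Set.univ
      · exact Or.inl (Set.univ_subset_iff.1 (hu ▸ hmono t))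
      · obtain ⟨i, hi, hi'⟩ := hgrow t (hne t) hu
        have hlt : (R t).ncard < (R (t + 1)).ncard :=
          Set.ncard_lt_ncard ⟨hmono t, fun h => hi (h hi')⟩
        have := ih.resolve_left hu
        exact Or.inr (by omega)
  refine (hcard _).resolve_right (not_lt.2 ?_)
  rw [← Nat.card_eq_fintype_card, ← Set.ncard_univ]
  exact Set.ncard_le_ncard (Set.subset_univ _)

/-- The positive values of a real function on a finite type are bounded below by some
`η ∈ (0, 1]`. -/
lemma exists_pos_le_of_pos {ι : Type*} [Finite ι] [Nonempty ι] (F : ι → ℝ) :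
    ∃ η : ℝ, 0 < η ∧ η ≤ 1 ∧ ∀ x, 0 < F x → η ≤ F x := by
  obtain ⟨x₀, hx₀⟩ := Finite.exists_min fun x => if 0 < F x then F x else 1
  refine ⟨min 1 (if 0 < F x₀ then F x₀ else 1), lt_min one_pos ?_, min_le_left _ _,
    fun x hx => (min_le_right _ _).trans ?_⟩
  · split_ifs with h
    exacts [h, one_pos]
  · simpa [hx] using hx₀ x

lemma Matrix.mul_le_mulVec {S : Type*} [Fintype S]
    {M : Matrix S S ℝ} (hM : ∀ i j, 0 ≤ M i j) {v : S → ℝ} (hv : ∀ i, 0 ≤ v i) (i j : S) :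
    M i j * v j ≤ (M.mulVec v) i :=
  Finset.single_le_sum (f := fun l => M i l * v l)
    (fun l _ => mul_nonneg (hM i l) (hv l)) (Finset.mem_univ j)

lemma Matrix.pow_le_pow_apply {S : Type*} [Fintype S] [DecidableEq S]
    {M : Matrix S S ℝ} (hM : ∀ i j, 0 ≤ M i j) {η : ℝ} (hη : 0 ≤ η) (hdiag : ∀ i, η ≤ M i i)
    {i j : S} (hij : η ≤ M i j) {k : ℕ} (hk : 1 ≤ k) : η ^ k ≤ (M ^ k) i j := by
  induction k, hk using Nat.le_induction with
  | base => simpa using hij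
  | succ k _ ih =>
    rw [pow_succ, pow_succ, Matrix.mul_apply]
    exact (mul_le_mul ih (hdiag j) hη (Matrix.pow_apply_nonneg hM k i j)).trans
      (Finset.single_le_sum (f := fun l => (M ^ k) i l * M l j)
        (fun l _ => mul_nonneg (Matrix.pow_apply_nonneg hM k i l) (hM l j)) (Finset.mem_univ j))

lemma Matrix.pow_mulVec_le {S : Type*} [Fintype S] [DecidableEq S]
    {M : Matrix S S ℝ} (hM : ∀ i j, 0 ≤ M i j) {v : S → ℝ} {U : ℝ} (hU : 0 ≤ U)
    (hv : ∀ i, (M.mulVec v) i ≤ U * v i) (k : ℕ) (i : S) :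
    ((M ^ k).mulVec v) i ≤ U ^ k * v i := by
  induction k generalizing i with
  | zero => simp
  | succ k ih =>
    rw [pow_succ', ← Matrix.mulVec_mulVec]
    calc (M.mulVec ((M ^ k).mulVec v)) i
        ≤ ∑ j, M i j * (U ^ k * v j) :=
          Finset.sum_le_sum fun j _ => mul_le_mul_of_nonneg_left (ih j) (hM i j)
      _ = U ^ k * (M.mulVec v) i := by
          rw [Matrix.mulVec, dotProduct, Finset.mul_sum]
          exact Finset.sum_congr rfl fun j _ => by ring
      _ ≤ U ^ k * (U * v i) := mul_le_mul_of_nonneg_left (hv i) (pow_nonneg hU k)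
      _ = U ^ (k + 1) * v i := by ring

/-- Applying a power of `M` to `v` propagates the slack in `M v ≤ B v`. -/
lemma Matrix.slack_pow_mulVec {S : Type*} [Fintype S] [DecidableEq S]
    {M : Matrix S S ℝ} (hM : ∀ i j, 0 ≤ M i j) {v : S → ℝ} {B : ℝ}
    (hv : ∀ i, (M.mulVec v) i ≤ B * v i) (k : ℕ) (i j : S) :
    (M ^ k) i j * (B * v j - (M.mulVec v) j) ≤
      B * ((M ^ k).mulVec v) i - (M.mulVec ((M ^ k).mulVec v)) i := by
  have h := Matrix.mul_le_mulVec (Matrix.pow_apply_nonneg hM k)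
    (v := B • v - M.mulVec v) (fun l => sub_nonneg.2 (hv l)) i j
  rw [Matrix.mulVec_sub, Matrix.mulVec_smul, Matrix.mulVec_mulVec, ← pow_succ, pow_succ',
    ← Matrix.mulVec_mulVec] at h
  exact h

/-- Harnack-type inequality for positive vectors with `M v ≤ U v`. -/
lemma Matrix.le_pow_card_mul {S : Type*} [Fintype S]
    {M : Matrix S S ℝ} (hM : ∀ i j, 0 ≤ M i j) {η : ℝ} (hη : 0 < η)
    (hedge : ∀ i j, 0 < M i j → η ≤ M i j)
    (hirr : ∀ R : Set S, R.Nonempty → R ≠ Set.univ → ∃ a ∉ R, ∃ b ∈ R, 0 < M a b)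
    {U : ℝ} (hηU : η ≤ U) {v : S → ℝ} (hv : ∀ i, 0 < v i)
    (hU : ∀ i, (M.mulVec v) i ≤ U * v i) (i j : S) :
    v i ≤ (U / η) ^ Fintype.card S * v j := by
  have hr : 1 ≤ U / η := (one_le_div hη).2 hηU
  have huniv := eq_univ_of_strict_growth (fun t => {l | v i ≤ (U / η) ^ t * v l})
    ⟨i, by simp⟩
    (fun t l (hl : v i ≤ _) => hl.trans
      (mul_le_mul_of_nonneg_right (pow_le_pow_right₀ hr t.le_succ) (hv l).le))
    (fun t hne hu => by
      obtain ⟨a, ha, b, hb, hab⟩ := hirr _ hne hu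
      refine ⟨a, ha, (show v i ≤ _ from hb).trans ?_⟩
      have hba : v b ≤ U / η * v a := by
        rw [div_mul_eq_mul_div, le_div_iff₀ hη, mul_comm]
        exact (mul_le_mul_of_nonneg_right (hedge a b hab) (hv b).le).trans
          ((Matrix.mul_le_mulVec hM (fun l => (hv l).le) a b).trans (hU a))
      rw [pow_succ, mul_assoc]
      exact mul_le_mul_of_nonneg_left hba (by positivity))
  exact Set.eq_univ_iff_forall.1 huniv j

/-- The weighted transition matrix of a policy, whose `mulVec` is the Bellman operator. -/
noncomputable def bellmanMatrix {S A : Type*}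
    (Q : S → A → S → ℝ) (d : S → A → ℝ) (α : ℝ) (f : S → A) : Matrix S S ℝ :=
  Matrix.of fun i j => Real.exp (α * d i (f i)) * Q i (f i) j

lemma Tpol_eq_mulVec {S A : Type*} [Fintype S]
    (Q : S → A → S → ℝ) (d : S → A → ℝ) (α : ℝ) (f : S → A) (v : S → ℝ) :
    Tpol Q d α f v = (bellmanMatrix Q d α f).mulVec v := by
  ext i
  simp [Tpol, bellmanMatrix, Matrix.mulVec, dotProduct, Finset.mul_sum, mul_assoc]

lemma Tpol_iterate_eq_mulVec {S A : Type*} [Fintype S] [DecidableEq S]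
    (Q : S → A → S → ℝ) (d : S → A → ℝ) (α : ℝ) (f : S → A) (v : S → ℝ) (k : ℕ) :
    (Tpol Q d α f)^[k] v = (bellmanMatrix Q d α f ^ k).mulVec v := by
  induction k with
  | zero => simp
  | succ k ih =>
    rw [Function.iterate_succ_apply', ih, Tpol_eq_mulVec, Matrix.mulVec_mulVec, ← pow_succ']

lemma Topt_le_Tpol {S A : Type*} [Fintype S] [Finite A] [Nonempty A]
    (Q : S → A → S → ℝ) (d : S → A → ℝ) (α : ℝ) (f : S → A) (v : S → ℝ) (i : S) :
    Topt Q d α v i ≤ Tpol Q d α f v i :=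
  ciInf_le (Set.finite_range _).bddBelow (f i)

/-- Key recursion in the proof of Theorem 4: if `m_k < C` for all `k`, then there exist an
integer `k ≥ 1` and `γ ∈ (0,1)` such that `u_n ≤ γ ℓ_{n-k} + (1-γ) u_{n-k}` for all
`n ≥ k`, where `u_n = max_i (T v'_n)(i)/v'_n(i)` and `ℓ_n = min_i (T v'_n)(i)/v'_n(i)`. -/
theorem mpi_key_recursion
    {S A : Type*} [Fintype S] [Fintype A] [Nonempty S] [Nonempty A] [DecidableEq S]
    (Q : S → A → S → ℝ) (d : S → A → ℝ) (α : ℝ) (hα : 0 < α)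
    (hQ0 : ∀ i a j, 0 ≤ Q i a j) (hQ1 : ∀ i a, ∑ j, Q i a j = 1)
    (hdiag : ∀ i a, 0 < Q i a i)
    (hirr : ∀ f : S → A, ∀ i j : S, ∃ k : ℕ, 1 ≤ k ∧ 0 < ((policyMatrix Q f) ^ k) i j)
    (m : ℕ → ℕ) (hm : ∀ k, 1 ≤ m k) (C : ℕ) (hC : ∀ k, m k < C)
    (v' : ℕ → S → ℝ) (f : ℕ → S → A)
    (hv0pos : ∀ i, 0 < v' 0 i) (hv0sum : ∑ i, v' 0 i = 1)
    (hgreedy : ∀ k i, Tpol Q d α (f (k + 1)) (v' k) i = Topt Q d α (v' k) i)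
    (hstep : ∀ k i, v' (k + 1) i =
      (Tpol Q d α (f (k + 1)))^[m k] (v' k) i /
        ∑ j, (Tpol Q d α (f (k + 1)))^[m k] (v' k) j) :
    ∃ k : ℕ, 1 ≤ k ∧ ∃ γ : ℝ, 0 < γ ∧ γ < 1 ∧ ∀ n : ℕ, k ≤ n →
      (⨆ i, Topt Q d α (v' n) i / v' n i) ≤
        γ * (⨅ i, Topt Q d α (v' (n - k)) i / v' (n - k) i) +
          (1 - γ) * (⨆ i, Topt Q d α (v' (n - k)) i / v' (n - k) i) := by
  set M : ℕ → Matrix S S ℝ := fun n => bellmanMatrix Q d α (f (n + 1)) with hMdef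
  set g : ℕ → S → ℝ := fun n i => Topt Q d α (v' n) i / v' n i with hgdef
  set N := Fintype.card S with hN
  have hM : ∀ n i j, 0 ≤ M n i j := fun n i j => mul_nonneg (Real.exp_pos _).le (hQ0 _ _ _)
  obtain ⟨η, hη, hη1, hηle⟩ := exists_pos_le_of_pos
    fun x : S × A × S => Real.exp (α * d x.1 x.2.1) * Q x.1 x.2.1 x.2.2
  have hedge : ∀ n i j, 0 < M n i j → η ≤ M n i j := fun n i j h => hηle (i, f (n + 1) i, j) h
  have hdiagM : ∀ n i, η ≤ M n i i := fun n i =>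
    hedge n i i (mul_pos (Real.exp_pos _) (hdiag _ _))
  have henter : ∀ n, ∀ R : Set S, R.Nonempty → R ≠ Set.univ →
      ∃ a ∉ R, ∃ b ∈ R, 0 < M n a b := by
    intro n R ⟨j, hj⟩ hR
    obtain ⟨i, hi⟩ := (Set.ne_univ_iff_exists_notMem R).1 hR
    obtain ⟨k, -, hk⟩ := hirr (f (n + 1)) i j
    obtain ⟨a, ha, b, hb, hab⟩ := Matrix.exists_pos_entry_of_pow_pos
      (fun i j => hQ0 i (f (n + 1) i) j) hi hj hk
    exact ⟨a, ha, b, hb, mul_pos (Real.exp_pos _) hab⟩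
  have hgreedyM : ∀ n i, ((M n).mulVec (v' n)) i = Topt Q d α (v' n) i := fun n i => by
    rw [← hgreedy n i, Tpol_eq_mulVec]
  have hpowpos : ∀ n, (∀ i, 0 < v' n i) → ∀ i, 0 < ((M n ^ m n).mulVec (v' n)) i := by
    intro n hn i
    refine lt_of_lt_of_le (mul_pos (pow_pos hη (m n)) (hn i)) (le_trans ?_
      (Matrix.mul_le_mulVec (Matrix.pow_apply_nonneg (hM n) (m n)) (fun l => (hn l).le) i i))
    exact mul_le_mul_of_nonneg_right
      (Matrix.pow_le_pow_apply (hM n) hη.le (hdiagM n) (hdiagM n i) (hm n)) (hn i).le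
  have hstepM : ∀ n, v' (n + 1) =
      (∑ j, ((M n ^ m n).mulVec (v' n)) j)⁻¹ • (M n ^ m n).mulVec (v' n) := by
    intro n
    ext i
    rw [hstep n i, Tpol_iterate_eq_mulVec, Pi.smul_apply, smul_eq_mul, div_eq_inv_mul]
  have hsum : ∀ n, (∀ i, 0 < v' n i) → 0 < ∑ j, ((M n ^ m n).mulVec (v' n)) j := fun n hn =>
    Finset.sum_pos (fun j _ => hpowpos n hn j) Finset.univ_nonempty
  have hvpos : ∀ n i, 0 < v' n i := by
    intro n
    induction n with
    | zero => exact hv0pos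
    | succ n ih =>
      intro i
      rw [hstepM n]
      exact mul_pos (inv_pos.2 (hsum n ih)) (hpowpos n ih i)
  have hg_next : ∀ n i, g (n + 1) i ≤
      ((M n).mulVec ((M n ^ m n).mulVec (v' n))) i / ((M n ^ m n).mulVec (v' n)) i := by
    intro n i
    have h := Topt_le_Tpol Q d α (f (n + 1)) (v' (n + 1)) i
    rw [Tpol_eq_mulVec] at h
    refine (div_le_div_of_nonneg_right h (hvpos (n + 1) i).le).trans_eq ?_
    rw [hstepM n, Matrix.mulVec_smul, Pi.smul_apply, Pi.smul_apply, smul_eq_mul, smul_eq_mul,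
      mul_div_mul_left _ _ (inv_pos.2 (hsum n (hvpos n))).ne']
  have hMv : ∀ n i, ((M n).mulVec (v' n)) i = g n i * v' n i := fun n i => by
    rw [hgreedyM, div_mul_cancel₀ _ (hvpos n i).ne']
  set U := max 1 (⨆ i, g 0 i) with hUdef
  have hU1 : 1 ≤ U := le_max_left _ _
  set K := U ^ C * (U / η) ^ N with hKdef
  have hr : 1 ≤ U / η := (one_le_div hη).2 (hη1.trans hU1)
  have hK : 1 ≤ K := one_le_mul_of_one_le_of_one_le (one_le_pow₀ hU1) (one_le_pow₀ hr)
  set δ := η ^ C / K / 2 with hδdef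
  have hδ : 0 < δ := by positivity
  have hδ1 : δ < 1 := by
    have : η ^ C / K ≤ 1 := (div_le_one (by positivity)).2 ((pow_le_one₀ hη.le hη1).trans hK)
    linarith
  have hkey : ∀ n, (∀ i, g n i ≤ U) → ∀ B, (∀ i, g n i ≤ B) → ∀ i j, 0 < M n i j →
      δ * (B - g n j) ≤ B - g (n + 1) i := by
    intro n hnU B hB i j hij
    set w := (M n ^ m n).mulVec (v' n) with hw
    have hwi : 0 < w i := hpowpos n (hvpos n) i
    have hMU : ∀ i, ((M n).mulVec (v' n)) i ≤ U * v' n i := fun i => by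
      rw [hMv]
      exact mul_le_mul_of_nonneg_right (hnU i) (hvpos n i).le
    have hwK : w i ≤ K * v' n j := by
      calc w i ≤ U ^ m n * v' n i := Matrix.pow_mulVec_le (hM n) (by linarith) hMU _ i
        _ ≤ U ^ C * v' n i :=
          mul_le_mul_of_nonneg_right (pow_le_pow_right₀ hU1 (hC n).le) (hvpos n i).le
        _ ≤ U ^ C * ((U / η) ^ N * v' n j) :=
          mul_le_mul_of_nonneg_left (Matrix.le_pow_card_mul (hM n) hη (hedge n) (henter n)
            (hη1.trans hU1) (hvpos n) hMU i j) (by positivity)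
        _ = K * v' n j := by rw [hKdef, mul_assoc]
    have hslack := Matrix.slack_pow_mulVec (hM n) (v := v' n) (B := B) (fun i => by
      rw [hMv]
      exact mul_le_mul_of_nonneg_right (hB i) (hvpos n i).le) (m n) i j
    rw [hMv, ← sub_mul] at hslack
    have hBj : 0 ≤ B - g n j := sub_nonneg.2 (hB j)
    have hηpow : η ^ C ≤ (M n ^ m n) i j :=
      (pow_le_pow_of_le_one hη.le hη1 (hC n).le).trans
        (Matrix.pow_le_pow_apply (hM n) hη.le (hdiagM n) (hedge n i j hij) (hm n))
    have hδw : δ * w i ≤ η ^ C * v' n j := by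
      calc δ * w i ≤ η ^ C / K * (K * v' n j) :=
            mul_le_mul (half_le_self (by positivity)) hwK hwi.le (by positivity)
        _ = η ^ C * v' n j := by
            have : K ≠ 0 := by positivity
            field_simp
    have hmain : δ * (B - g n j) * w i ≤ B * w i - ((M n).mulVec w) i := by
      calc δ * (B - g n j) * w i = δ * w i * (B - g n j) := by ring
        _ ≤ η ^ C * v' n j * (B - g n j) := mul_le_mul_of_nonneg_right hδw hBj
        _ = η ^ C * ((B - g n j) * v' n j) := by ring
        _ ≤ (M n ^ m n) i j * ((B - g n j) * v' n j) :=
          mul_le_mul_of_nonneg_right hηpow (mul_nonneg hBj (hvpos n j).le)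
        _ ≤ _ := hslack
    have hdiv := (le_div_iff₀ hwi).2 hmain
    rw [sub_div, mul_div_cancel_right₀ _ hwi.ne'] at hdiv
    exact hdiv.trans (sub_le_sub_left (hg_next n i) B)
  have hloop : ∀ n i, 0 < M n i i := fun n i => hη.trans_le (hdiagM n i)
  have hbound : ∀ n, (∀ i, g n i ≤ U) → ∀ B, (∀ i, g n i ≤ B) → ∀ i, g (n + 1) i ≤ B :=
    fun n hnU B hB i => sub_nonneg.1 <|
      (mul_nonneg hδ.le (sub_nonneg.2 (hB i))).trans (hkey n hnU B hB i i (hloop n i))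
  have hle_sup : ∀ n i, g n i ≤ ⨆ i, g n i := fun n i =>
    le_ciSup (Set.finite_range (g n)).bddAbove i
  have hgU : ∀ n i, g n i ≤ U := by
    intro n
    induction n with
    | zero => exact fun i => (hle_sup 0 i).trans (le_max_right _ _)
    | succ n ih => exact hbound n ih U ih
  refine ⟨N, Fintype.card_pos, δ ^ N, pow_pos hδ N, pow_lt_one₀ hδ.le hδ1 Fintype.card_ne_zero,
    fun n hn => ?_⟩
  obtain ⟨a, rfl⟩ := Nat.exists_eq_add_of_le' hn
  rw [Nat.add_sub_cancel]
  change (⨆ i, g (a + N) i) ≤ δ ^ N * (⨅ i, g a i) + (1 - δ ^ N) * (⨆ i, g a i)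
  set B := ⨆ i, g a i with hBdef
  have hgB : ∀ t i, g (a + t) i ≤ B := by
    intro t
    induction t with
    | zero => exact hle_sup a
    | succ t ih => exact hbound (a + t) (hgU _) B ih
  obtain ⟨j₀, hj₀⟩ := exists_eq_ciInf_of_finite (f := g a)
  have hprop : ∀ t i j, 0 < M (a + t) i j → δ ^ t * (B - ⨅ i, g a i) ≤ B - g (a + t) j →
      δ ^ (t + 1) * (B - ⨅ i, g a i) ≤ B - g (a + (t + 1)) i := by
    intro t i j hij hj
    rw [pow_succ', mul_assoc]
    exact (mul_le_mul_of_nonneg_left hj hδ.le).trans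
      (hkey (a + t) (hgU _) B (hgB t) i j hij)
  have huniv := eq_univ_of_strict_growth
    (fun t => {i | δ ^ t * (B - ⨅ i, g a i) ≤ B - g (a + t) i})
    ⟨j₀, by simp [hj₀]⟩
    (fun t i hi => hprop t i i (hloop _ i) hi)
    (fun t hne hu => by
      obtain ⟨i, hi, j, hj, hij⟩ := henter (a + t) _ hne hu
      exact ⟨i, hi, hprop t i j hij hj⟩)
  refine ciSup_le fun i => ?_
  have hi : δ ^ N * (B - ⨅ i, g a i) ≤ B - g (a + N) i :=
    Set.eq_univ_iff_forall.1 huniv i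
  linarith
end

section
/- (Theorem 4, contraction) Suppose m_k < C for all k, and let (λ*, v*) be a solution of the multiplicative Bellman optimality equation (λ* = e^{Λ̃*}). Then u_n converges to λ* exponentially fast: there exist γ ∈ (0,1) and an integer k ≥ 1 such that for all n ≥ k, u_n − λ* ≤ (1 − γ)(u_{n−k} − λ*). -/
section Bellman

variable {S A : Type*} [Fintype S] {Q : S → A → S → ℝ} {d : S → A → ℝ} {α : ℝ}

theorem Tpol_mono (hQ0 : ∀ i a j, 0 ≤ Q i a j) (f : S → A) {v w : S → ℝ}
    (h : ∀ i, v i ≤ w i) (i : S) : Tpol Q d α f v i ≤ Tpol Q d α f w i :=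
  mul_le_mul_of_nonneg_left
    (Finset.sum_le_sum fun j _ => mul_le_mul_of_nonneg_left (h j) (hQ0 i (f i) j))
    (Real.exp_nonneg _)

theorem Tpol_const_mul (f : S → A) (c : ℝ) (v : S → ℝ) :
    Tpol Q d α f (fun i => c * v i) = fun i => c * Tpol Q d α f v i := by
  funext i
  simp only [Tpol, Finset.mul_sum]
  exact Finset.sum_congr rfl fun j _ => by ring

theorem Tpol_sub (f : S → A) (v w : S → ℝ) :
    Tpol Q d α f (fun i => v i - w i) = fun i => Tpol Q d α f v i - Tpol Q d α f w i := by
  funext i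
  simp only [Tpol, mul_sub, Finset.sum_sub_distrib]

theorem Tpol_iterate_mul_sub (f : S → A) (c : ℝ) (v w : S → ℝ) (m : ℕ) :
    (Tpol Q d α f)^[m] (fun i => c * v i - w i) =
      fun i => c * (Tpol Q d α f)^[m] v i - (Tpol Q d α f)^[m] w i := by
  induction m with
  | zero => rfl
  | succ m ih => simp only [Function.iterate_succ_apply', ih, Tpol_sub, Tpol_const_mul]

theorem Tpol_nonneg (hQ0 : ∀ i a j, 0 ≤ Q i a j) (f : S → A) {v : S → ℝ}
    (hv : ∀ i, 0 ≤ v i) (i : S) : 0 ≤ Tpol Q d α f v i :=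
  mul_nonneg (Real.exp_nonneg _) (Finset.sum_nonneg fun j _ => mul_nonneg (hQ0 _ _ _) (hv j))

theorem Tpol_iterate_nonneg (hQ0 : ∀ i a j, 0 ≤ Q i a j) (f : S → A) {v : S → ℝ}
    (hv : ∀ i, 0 ≤ v i) (m : ℕ) (i : S) : 0 ≤ (Tpol Q d α f)^[m] v i := by
  induction m generalizing i with
  | zero => exact hv i
  | succ m ih =>
    rw [Function.iterate_succ_apply']
    exact Tpol_nonneg hQ0 f ih i

theorem mul_le_Tpol (hQ0 : ∀ i a j, 0 ≤ Q i a j) (f : S → A) {v : S → ℝ}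
    (hv : ∀ i, 0 ≤ v i) (i j : S) :
    Real.exp (α * d i (f i)) * Q i (f i) j * v j ≤ Tpol Q d α f v i := by
  rw [mul_assoc]
  exact mul_le_mul_of_nonneg_left
    (Finset.single_le_sum (f := fun j => Q i (f i) j * v j)
      (fun j _ => mul_nonneg (hQ0 _ _ _) (hv j)) (Finset.mem_univ j)) (Real.exp_nonneg _)

theorem Tpol_iterate_pos (hQ0 : ∀ i a j, 0 ≤ Q i a j) (hdiag : ∀ i a, 0 < Q i a i) (f : S → A)
    {v : S → ℝ} (hv : ∀ i, 0 < v i) (m : ℕ) (i : S) : 0 < (Tpol Q d α f)^[m] v i := by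
  induction m generalizing i with
  | zero => exact hv i
  | succ m ih =>
    rw [Function.iterate_succ_apply']
    exact lt_of_lt_of_le (mul_pos (mul_pos (Real.exp_pos _) (hdiag i (f i))) (ih i))
      (mul_le_Tpol hQ0 f (fun j => (ih j).le) i i)

theorem Tpol_iterate_le_pow_mul (hQ0 : ∀ i a j, 0 ≤ Q i a j) (f : S → A) {v : S → ℝ} {U : ℝ}
    (hU : 0 ≤ U) (h : ∀ i, Tpol Q d α f v i ≤ U * v i) (m : ℕ) (i : S) :
    (Tpol Q d α f)^[m] v i ≤ U ^ m * v i := by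
  induction m generalizing i with
  | zero => simp
  | succ m ih =>
    rw [Function.iterate_succ_apply']
    calc Tpol Q d α f ((Tpol Q d α f)^[m] v) i
        ≤ Tpol Q d α f (fun i => U ^ m * v i) i := Tpol_mono hQ0 f ih i
      _ = U ^ m * Tpol Q d α f v i := by rw [Tpol_const_mul]
      _ ≤ U ^ m * (U * v i) := mul_le_mul_of_nonneg_left (h i) (pow_nonneg hU m)
      _ = U ^ (m + 1) * v i := by ring

theorem Topt_le [Finite A] [Nonempty A] (v : S → ℝ) (i : S) (a : A) :
    Topt Q d α v i ≤ Real.exp (α * d i a) * ∑ j, Q i a j * v j :=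
  ciInf_le (Set.finite_range _).bddBelow a

theorem Topt_le_mul_Topt [Finite A] [Nonempty A] (hQ0 : ∀ i a j, 0 ≤ Q i a j) {v w : S → ℝ}
    {c : ℝ} (h : ∀ i, v i ≤ c * w i) (i : S) : Topt Q d α v i ≤ c * Topt Q d α w i := by
  obtain ⟨a, ha⟩ := exists_eq_ciInf_of_finite
    (f := fun a : A => Real.exp (α * d i a) * ∑ j, Q i a j * w j)
  calc Topt Q d α v i ≤ Tpol Q d α (fun _ => a) v i := Topt_le v i a
    _ ≤ Tpol Q d α (fun _ => a) (fun j => c * w j) i := Tpol_mono hQ0 _ h i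
    _ = c * Tpol Q d α (fun _ => a) w i := by rw [Tpol_const_mul]
    _ = c * Topt Q d α w i := by rw [Topt, ← ha]; rfl

/-- Collatz–Wielandt comparison: for positive `v` and `w`, some state has a Bellman ratio for `v`
at most the one for `w`. -/
theorem exists_Topt_mul_le [Nonempty S] [Finite A] [Nonempty A] (hQ0 : ∀ i a j, 0 ≤ Q i a j)
    {v w : S → ℝ} (hw : ∀ i, 0 < w i) :
    ∃ i, Topt Q d α v i * w i ≤ Topt Q d α w i * v i := by
  obtain ⟨i, hi⟩ := Finite.exists_max fun i => v i / w i
  refine ⟨i, ?_⟩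
  have h := Topt_le_mul_Topt (d := d) (α := α) hQ0 (v := v) (w := w) (c := v i / w i)
    (fun j => (div_le_iff₀ (hw j)).1 (hi j)) i
  calc Topt Q d α v i * w i ≤ v i / w i * Topt Q d α w i * w i :=
        mul_le_mul_of_nonneg_right h (hw i).le
    _ = Topt Q d α w i * v i := by
        have := (hw i).ne'
        field_simp

theorem exists_kernel_pos_of_irreducible [DecidableEq S] {f : S → A}
    (hQ0 : ∀ i a j, 0 ≤ Q i a j)
    (hirr : ∀ i j : S, ∃ k : ℕ, 1 ≤ k ∧ 0 < ((policyMatrix Q f) ^ k) i j)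
    {X : Finset S} (hX : X.Nonempty) (hX' : X ≠ Finset.univ) :
    ∃ i ∉ X, ∃ j ∈ X, 0 < Q i (f i) j := by
  by_contra! hcon
  obtain ⟨j, hj⟩ := hX
  obtain ⟨i, hi⟩ : ∃ i, i ∉ X := by
    by_contra! h
    exact hX' (Finset.eq_univ_of_forall h)
  have hzero : ∀ k, ∀ i ∉ X, ((policyMatrix Q f) ^ k) i j = 0 := by
    intro k
    induction k with
    | zero =>
      intro i hi
      rw [pow_zero, Matrix.one_apply_ne]
      rintro rfl
      exact hi hj
    | succ k ih =>
      intro i hi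
      rw [pow_succ', Matrix.mul_apply]
      refine Finset.sum_eq_zero fun l _ => ?_
      by_cases hl : l ∈ X
      · have : policyMatrix Q f i l = 0 := le_antisymm (hcon i hi l hl) (hQ0 _ _ _)
        rw [this, zero_mul]
      · rw [ih l hl, mul_zero]
  obtain ⟨k, -, hk⟩ := hirr i j
  exact hk.ne' (hzero k i hi)

theorem exists_weight_lower_bound [Nonempty S] [Finite A] [Nonempty A] (Q : S → A → S → ℝ)
    (d : S → A → ℝ) (α : ℝ) :
    ∃ δ : ℝ, 0 < δ ∧ δ ≤ 1 ∧ ∀ i a j, 0 < Q i a j → δ ≤ Real.exp (α * d i a) * Q i a j := by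
  classical
  obtain ⟨p, hp⟩ := Finite.exists_min fun p : S × A × S =>
    if 0 < Q p.1 p.2.1 p.2.2 then Real.exp (α * d p.1 p.2.1) * Q p.1 p.2.1 p.2.2 else 1
  refine ⟨min 1 (if 0 < Q p.1 p.2.1 p.2.2 then
    Real.exp (α * d p.1 p.2.1) * Q p.1 p.2.1 p.2.2 else 1), ?_, min_le_left _ _, ?_⟩
  · refine lt_min one_pos ?_
    split_ifs with h
    · exact mul_pos (Real.exp_pos _) h
    · exact one_pos
  · intro i a j h
    refine (min_le_right _ _).trans ((hp (i, a, j)).trans ?_)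
    simp [h]

theorem exists_card_lt_forall_le_Tpol [DecidableEq S] {f : S → A}
    (hQ0 : ∀ i a j, 0 ≤ Q i a j) (hdiag : ∀ i a, 0 < Q i a i)
    (hirr : ∀ i j : S, ∃ k : ℕ, 1 ≤ k ∧ 0 < ((policyMatrix Q f) ^ k) i j)
    {δ : ℝ} (hδ0 : 0 ≤ δ) (hδ : ∀ i a j, 0 < Q i a j → δ ≤ Real.exp (α * d i a) * Q i a j)
    {w : S → ℝ} (hw : ∀ i, 0 ≤ w i) {X : Finset S} (hX : X.Nonempty) {β : ℝ}
    (hβ : ∀ x ∈ X, β ≤ w x) :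
    ∃ Y : Finset S, min (X.card + 1) (Fintype.card S) ≤ Y.card ∧
      ∀ x ∈ Y, δ * β ≤ Tpol Q d α f w x := by
  have key : ∀ i, ∀ j ∈ X, 0 < Q i (f i) j → δ * β ≤ Tpol Q d α f w i := fun i j hj h =>
    ((mul_le_mul_of_nonneg_left (hβ j hj) hδ0).trans
      (mul_le_mul_of_nonneg_right (hδ _ _ _ h) (hw j))).trans (mul_le_Tpol hQ0 f hw i j)
  by_cases hX' : X = Finset.univ
  · refine ⟨X, ?_, fun x hx => key x x hx (hdiag _ _)⟩
    rw [hX', Finset.card_univ]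
    exact min_le_right _ _
  · obtain ⟨i, hi, j, hj, hij⟩ := exists_kernel_pos_of_irreducible hQ0 hirr hX hX'
    refine ⟨insert i X, ?_, ?_⟩
    · rw [Finset.card_insert_of_notMem hi]
      exact min_le_left _ _
    · intro x hx
      rcases Finset.mem_insert.1 hx with rfl | hx
      · exact key _ j hj hij
      · exact key x x hx (hdiag _ _)

theorem exists_card_lt_forall_le_Tpol_iterate [DecidableEq S] {f : S → A}
    (hQ0 : ∀ i a j, 0 ≤ Q i a j) (hdiag : ∀ i a, 0 < Q i a i)
    (hirr : ∀ i j : S, ∃ k : ℕ, 1 ≤ k ∧ 0 < ((policyMatrix Q f) ^ k) i j)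
    {δ : ℝ} (hδ0 : 0 ≤ δ) (hδ : ∀ i a j, 0 < Q i a j → δ ≤ Real.exp (α * d i a) * Q i a j)
    {w : S → ℝ} (hw : ∀ i, 0 ≤ w i) {X : Finset S} (hX : X.Nonempty) {β : ℝ}
    (hβ : ∀ x ∈ X, β ≤ w x) (m : ℕ) :
    ∃ Y : Finset S, min (X.card + 1) (Fintype.card S) ≤ Y.card ∧
      ∀ x ∈ Y, δ ^ (m + 1) * β ≤ (Tpol Q d α f)^[m + 1] w x := by
  induction m with
  | zero =>
    simpa using exists_card_lt_forall_le_Tpol hQ0 hdiag hirr hδ0 hδ hw hX hβ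
  | succ m ih =>
    obtain ⟨Y, hY, h⟩ := ih
    refine ⟨Y, hY, fun x hx => ?_⟩
    rw [Function.iterate_succ_apply']
    have hnn := Tpol_iterate_nonneg (d := d) (α := α) hQ0 f hw (m + 1)
    calc δ ^ (m + 1 + 1) * β = δ * (δ ^ (m + 1) * β) := by ring
      _ ≤ δ * (Tpol Q d α f)^[m + 1] w x := mul_le_mul_of_nonneg_left (h x hx) hδ0
      _ ≤ Real.exp (α * d x (f x)) * Q x (f x) x * (Tpol Q d α f)^[m + 1] w x :=
        mul_le_mul_of_nonneg_right (hδ _ _ _ (hdiag _ _)) (hnn x)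
      _ ≤ _ := mul_le_Tpol hQ0 f hnn x x

/-- If the set on which `w t` is bounded below grows at each step, at the price of a factor `κ`,
then a lower bound at one state spreads to all states in `Fintype.card S` steps. -/
theorem pow_card_mul_le_of_spread [Nonempty S] {w : ℕ → S → ℝ} {κ : ℝ} (hκ : 0 ≤ κ)
    (hspread : ∀ t (X : Finset S) (β : ℝ), X.Nonempty → 0 ≤ β → (∀ x ∈ X, β ≤ w t x) →
      ∃ Y : Finset S, min (X.card + 1) (Fintype.card S) ≤ Y.card ∧ ∀ x ∈ Y, κ * β ≤ w (t + 1) x)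
    {β : ℝ} (hβ : 0 ≤ β) {j : S} (hj : β ≤ w 0 j) (x : S) :
    κ ^ Fintype.card S * β ≤ w (Fintype.card S) x := by
  have hcard : 0 < Fintype.card S := Fintype.card_pos
  have key : ∀ t, ∃ Y : Finset S, min (t + 1) (Fintype.card S) ≤ Y.card ∧
      ∀ x ∈ Y, κ ^ t * β ≤ w t x := by
    intro t
    induction t with
    | zero => exact ⟨{j}, by simp, by simpa using hj⟩
    | succ t ih =>
      obtain ⟨X, hX, h⟩ := ih
      obtain ⟨Y, hY, h'⟩ := hspread t X (κ ^ t * β) (Finset.card_pos.1 (by omega))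
        (by positivity) h
      refine ⟨Y, by omega, fun x hx => ?_⟩
      rw [pow_succ', mul_assoc]
      exact h' x hx
  obtain ⟨Y, hY, h⟩ := key (Fintype.card S)
  have hY' : Y = Finset.univ :=
    (Finset.card_eq_iff_eq_univ Y).1 (le_antisymm (Finset.card_le_univ Y) (by omega))
  exact h x (hY' ▸ Finset.mem_univ x)

/-- A positive probability vector `v` with `T_f v ≤ U v` is bounded below in terms of `U` and the
smallest positive weight only. -/
theorem pow_card_div_card_le [Nonempty S] [DecidableEq S] {f : S → A}
    (hQ0 : ∀ i a j, 0 ≤ Q i a j) (hdiag : ∀ i a, 0 < Q i a i)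
    (hirr : ∀ i j : S, ∃ k : ℕ, 1 ≤ k ∧ 0 < ((policyMatrix Q f) ^ k) i j)
    {δ : ℝ} (hδ0 : 0 ≤ δ) (hδ : ∀ i a j, 0 < Q i a j → δ ≤ Real.exp (α * d i a) * Q i a j)
    {v : S → ℝ} (hv : ∀ i, 0 ≤ v i) (hsum : ∑ i, v i = 1) {U : ℝ} (hU : 0 < U)
    (h : ∀ i, Tpol Q d α f v i ≤ U * v i) (x : S) :
    (δ / U) ^ Fintype.card S * (1 / Fintype.card S) ≤ v x := by
  obtain ⟨j, hj⟩ := Finite.exists_max v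
  have hcard : (0 : ℝ) < Fintype.card S := by exact_mod_cast Fintype.card_pos
  have hj' : 1 / (Fintype.card S : ℝ) ≤ v j := by
    rw [div_le_iff₀ hcard, ← hsum, mul_comm, ← nsmul_eq_mul]
    exact Finset.sum_le_card_nsmul Finset.univ v (v j) fun i _ => hj i
  refine pow_card_mul_le_of_spread (w := fun _ => v) (by positivity) ?_ (by positivity) hj' x
  intro _ X β hX _ hβ
  obtain ⟨Y, hY, hYβ⟩ := exists_card_lt_forall_le_Tpol hQ0 hdiag hirr hδ0 hδ hv hX hβ
  refine ⟨Y, hY, fun x hx => ?_⟩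
  rw [div_mul_eq_mul_div, div_le_iff₀ hU, mul_comm (v x)]
  exact (hYβ x hx).trans (h x)

/-- One step of modified policy iteration applies the (normalised) iterated operator of the greedy
policy to the gap `c v - T v`, up to a gain. -/
theorem Tpol_iterate_gap_div_le [Finite A] [Nonempty A] {f : S → A}
    {v v₁ : S → ℝ} {m : ℕ} (hgreedy : ∀ i, Tpol Q d α f v i = Topt Q d α v i)
    {s : ℝ} (hstep : ∀ i, v₁ i = (Tpol Q d α f)^[m] v i / s) (c : ℝ) (i : S) :
    (Tpol Q d α f)^[m] (fun j => c * v j - Topt Q d α v j) i / s ≤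
      c * v₁ i - Topt Q d α v₁ i := by
  have h1 : Topt Q d α v₁ i ≤ Tpol Q d α f v₁ i := Topt_le v₁ i (f i)
  have h2 : v₁ = fun i => s⁻¹ * (Tpol Q d α f)^[m] v i := by
    funext i
    rw [hstep, div_eq_inv_mul]
  have h3 : Tpol Q d α f v₁ i = s⁻¹ * (Tpol Q d α f)^[m] (Topt Q d α v) i := by
    have h4 : Tpol Q d α f v = Topt Q d α v := funext hgreedy
    rw [h2, Tpol_const_mul, ← h4, ← Function.iterate_succ_apply, Function.iterate_succ_apply']
  have h5 := congrFun (Tpol_iterate_mul_sub (Q := Q) (d := d) (α := α) f c v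
    (fun j => Topt Q d α v j) m) i
  rw [h5, hstep i, div_eq_inv_mul, div_eq_inv_mul]
  rw [h3] at h1
  linarith

end Bellman

/-- Theorem 4 (contraction): if `m_k < C` for all `k` and `(λ*, v*)` solves the
multiplicative Bellman optimality equation, then there are `γ ∈ (0,1)` and `k ≥ 1` with
`u_n − λ* ≤ (1 − γ)(u_{n−k} − λ*)` for all `n ≥ k`. -/
theorem mpi_contraction
    {S A : Type*} [Fintype S] [Fintype A] [Nonempty S] [Nonempty A] [DecidableEq S]
    (Q : S → A → S → ℝ) (d : S → A → ℝ) (α : ℝ) (hα : 0 < α)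
    (hQ0 : ∀ i a j, 0 ≤ Q i a j) (hQ1 : ∀ i a, ∑ j, Q i a j = 1)
    (hdiag : ∀ i a, 0 < Q i a i)
    (hirr : ∀ f : S → A, ∀ i j : S, ∃ k : ℕ, 1 ≤ k ∧ 0 < ((policyMatrix Q f) ^ k) i j)
    (m : ℕ → ℕ) (hm : ∀ k, 1 ≤ m k) (C : ℕ) (hC : ∀ k, m k < C)
    (lamStar : ℝ) (vStar : S → ℝ)
    (hlamStar : 0 < lamStar) (hvStar : ∀ i, 0 < vStar i)
    (hopt : ∀ i, lamStar * vStar i = Topt Q d α vStar i)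
    (v' : ℕ → S → ℝ) (f : ℕ → S → A)
    (hv0pos : ∀ i, 0 < v' 0 i) (hv0sum : ∑ i, v' 0 i = 1)
    (hgreedy : ∀ k i, Tpol Q d α (f (k + 1)) (v' k) i = Topt Q d α (v' k) i)
    (hstep : ∀ k i, v' (k + 1) i =
      (Tpol Q d α (f (k + 1)))^[m k] (v' k) i /
        ∑ j, (Tpol Q d α (f (k + 1)))^[m k] (v' k) j) :
    ∃ γ : ℝ, 0 < γ ∧ γ < 1 ∧ ∃ k : ℕ, 1 ≤ k ∧ ∀ n : ℕ, k ≤ n →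
      (⨆ i, Topt Q d α (v' n) i / v' n i) - lamStar ≤
        (1 - γ) * ((⨆ i, Topt Q d α (v' (n - k)) i / v' (n - k) i) - lamStar) := by
  obtain ⟨δ, hδ0, hδ1, hδ⟩ := exists_weight_lower_bound Q d α
  have hv : ∀ n, (∀ i, 0 < v' n i) ∧ ∑ i, v' n i = 1 := by
    intro n
    induction n with
    | zero => exact ⟨hv0pos, hv0sum⟩
    | succ n ih =>
      have hpos := Tpol_iterate_pos (d := d) (α := α) hQ0 hdiag (f (n + 1)) ih.1 (m n)
      have hs := Finset.sum_pos (fun j _ => hpos j) Finset.univ_nonempty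
      refine ⟨fun i => ?_, ?_⟩
      · rw [hstep]
        exact div_pos (hpos i) hs
      · simp_rw [hstep]
        rw [← Finset.sum_div, div_self hs.ne']
  have hle_one : ∀ n i, v' n i ≤ 1 := fun n i =>
    (hv n).2 ▸ Finset.single_le_sum (fun j _ => ((hv n).1 j).le) (Finset.mem_univ i)
  have hs_pos : ∀ n, 0 < ∑ j, (Tpol Q d α (f (n + 1)))^[m n] (v' n) j := fun n =>
    Finset.sum_pos (fun j _ => Tpol_iterate_pos hQ0 hdiag _ (hv n).1 _ j) Finset.univ_nonempty
  have hgap : ∀ c n i, _ ≤ c * v' (n + 1) i - Topt Q d α (v' (n + 1)) i := fun c n i =>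
    Tpol_iterate_gap_div_le (hgreedy n) (hstep n) c i
  have hgap_nonneg : ∀ c n, (∀ i, 0 ≤ c * v' n i - Topt Q d α (v' n) i) →
      ∀ t i, 0 ≤ c * v' (n + t) i - Topt Q d α (v' (n + t)) i := by
    intro c n h t
    induction t with
    | zero => exact h
    | succ t ih =>
      exact fun i => le_trans
        (div_nonneg (Tpol_iterate_nonneg hQ0 _ ih _ i) (hs_pos (n + t)).le) (hgap c (n + t) i)
  have hsup : ∀ n i, 0 ≤ (⨆ i, Topt Q d α (v' n) i / v' n i) * v' n i - Topt Q d α (v' n) i := by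
    intro n i
    rw [sub_nonneg, ← div_le_iff₀ ((hv n).1 i)]
    exact le_ciSup (f := fun i => Topt Q d α (v' n) i / v' n i) (Set.finite_range _).bddAbove i
  have hlam_le : ∀ n, lamStar ≤ ⨆ i, Topt Q d α (v' n) i / v' n i := by
    intro n
    obtain ⟨i, hi⟩ := exists_Topt_mul_le (d := d) (α := α) hQ0 (v := vStar) (hv n).1
    rw [← hopt, mul_right_comm] at hi
    have h2 := hsup n i
    have h3 := le_of_mul_le_mul_right hi (hvStar i)
    exact le_of_mul_le_mul_right (by linarith) ((hv n).1 i)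
  obtain ⟨U, hU1, hU⟩ : ∃ U : ℝ, 1 ≤ U ∧ ∀ n i, Topt Q d α (v' n) i ≤ U * v' n i := by
    refine ⟨max 1 (⨆ i, Topt Q d α (v' 0) i / v' 0 i), le_max_left _ _, fun n i => ?_⟩
    have h := hgap_nonneg (max 1 (⨆ i, Topt Q d α (v' 0) i / v' 0 i)) 0 (fun i =>
      (hsup 0 i).trans (sub_le_sub_right
        (mul_le_mul_of_nonneg_right (le_max_right _ _) ((hv 0).1 i).le) _)) n i
    rw [zero_add] at h
    exact sub_nonneg.1 h
  have hU0 : 0 < U := one_pos.trans_le hU1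
  have hTU : ∀ n i, Tpol Q d α (f (n + 1)) (v' n) i ≤ U * v' n i := fun n i =>
    (hgreedy n i).trans_le (hU n i)
  have hs_le : ∀ n, ∑ j, (Tpol Q d α (f (n + 1)))^[m n] (v' n) j ≤ U ^ C := by
    intro n
    calc _ ≤ ∑ j, U ^ m n * v' n j :=
          Finset.sum_le_sum fun j _ => Tpol_iterate_le_pow_mul hQ0 _ hU0.le (hTU n) _ j
      _ = U ^ m n := by rw [← Finset.mul_sum, (hv n).2, mul_one]
      _ ≤ U ^ C := pow_le_pow_right₀ hU1 (hC n).le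
  have hcard : (0 : ℝ) < Fintype.card S := by exact_mod_cast Fintype.card_pos
  set ε : ℝ := (δ / U) ^ Fintype.card S * (1 / Fintype.card S) with hε
  have hε0 : 0 < ε := by positivity
  have hvε : ∀ n i, ε ≤ v' n i := fun n i =>
    pow_card_div_card_le hQ0 hdiag (hirr _) hδ0.le hδ (fun i => ((hv n).1 i).le) (hv n).2 hU0
      (hTU n) i
  set κ : ℝ := δ ^ C / U ^ C with hκ
  have hκ0 : 0 < κ := by positivity
  have hη0 : 0 < κ ^ Fintype.card S * ε := by positivity
  have hcontract : ∀ n i, κ ^ Fintype.card S *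
      (((⨆ i, Topt Q d α (v' n) i / v' n i) - lamStar) * ε) ≤
      (⨆ i, Topt Q d α (v' n) i / v' n i) * v' (n + Fintype.card S) i -
        Topt Q d α (v' (n + Fintype.card S)) i := by
    intro n i
    obtain ⟨j, hj⟩ := exists_Topt_mul_le (d := d) (α := α) hQ0 (v := v' n) hvStar
    rw [← hopt, mul_right_comm] at hj
    have hj' := le_of_mul_le_mul_right hj (hvStar j)
    have hn := hgap_nonneg _ n (hsup n)
    have hlam := sub_nonneg.2 (hlam_le n)
    generalize (⨆ i, Topt Q d α (v' n) i / v' n i) = u at hn hlam ⊢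
    refine pow_card_mul_le_of_spread
      (w := fun t i => u * v' (n + t) i - Topt Q d α (v' (n + t)) i) hκ0.le ?_
      (mul_nonneg hlam hε0.le) (j := j) ?_ i
    · intro t X β hX hβ0 hβ
      obtain ⟨M, hM⟩ := Nat.exists_eq_add_of_le' (hm (n + t))
      obtain ⟨Y, hY, hYβ⟩ := exists_card_lt_forall_le_Tpol_iterate hQ0 hdiag
        (hirr (f (n + t + 1))) hδ0.le hδ (hn t) hX hβ M
      refine ⟨Y, hY, fun x hx => le_trans ?_ (hgap u (n + t) x)⟩
      have h1 := hYβ x hx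
      rw [← hM] at h1
      rw [hκ, div_mul_eq_mul_div]
      refine div_le_div₀ (Tpol_iterate_nonneg hQ0 _ (hn t) _ x) (le_trans ?_ h1)
        (hs_pos (n + t)) (hs_le (n + t))
      exact mul_le_mul_of_nonneg_right
        (pow_le_pow_of_le_one hδ0.le hδ1 (hC (n + t)).le) hβ0
    · have h1 := mul_le_mul_of_nonneg_left (hvε n j) hlam
      simp only [add_zero]
      linarith
  refine ⟨min (1 / 2) (κ ^ Fintype.card S * ε), lt_min (by norm_num) hη0,
    (min_le_left _ _).trans_lt (by norm_num), Fintype.card S, Fintype.card_pos, fun n hn => ?_⟩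
  obtain ⟨p, rfl⟩ := Nat.exists_eq_add_of_le' hn
  rw [Nat.add_sub_cancel, sub_le_iff_le_add]
  refine ciSup_le fun i => ?_
  have h1 := hcontract p i
  have hlam := sub_nonneg.2 (hlam_le p)
  generalize (⨆ i, Topt Q d α (v' p) i / v' p i) = u at h1 hlam ⊢
  rw [div_le_iff₀ ((hv _).1 i)]
  have h2 := mul_le_mul_of_nonneg_right (min_le_right (1 / 2) (κ ^ Fintype.card S * ε)) hlam
  have h3 : 0 ≤ min (1 / 2) (κ ^ Fintype.card S * ε) * (u - lamStar) :=
    mul_nonneg (le_min (by norm_num) hη0.le) hlam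
  have h4 := mul_le_of_le_one_right h3 (hle_one (p + Fintype.card S) i)
  linarith
end
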